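/- Assume each c_k is nonzero and lies in the range of Σ_{i=1}^s A_{(k),i}^T A_{(k),i}. A design w is S_β-optimal if and only if there exist a vector t ∈ ℝ^r with t_k > 0 for all k, vectors ε_{ik} ∈ ℝ^l for i ∈ {1,…,s}, k ∈ {1,…,r}, and a matrix H ∈ ℝ^{r×m} with rows h_1^T,…,h_r^T, such that: (i) Σ_{k=1}^r β_k ‖ε_{ik}‖² ≤ 1 for every i; (ii) the r×m matrix Diag(t)·C whose k-th row is t_k c_k^T equals Σ_{i=1}^s w_i B_i, where B_i is the r×m matrix whose k-th row is ε_{ik}^T A_{(k),i}; (iii) Diag(t)·C lies on the frontier (topological boundary) of D_β and ⟨H, D⟩ ≤ 1 for every D ∈ D_β, where ⟨H, D⟩ := trace(H D^T); (iv) t_k · (h_k^T c_k) = β_k for every k. In that case the optimal value of the S_β-criterion is S_β(w) = −2 Σ_{k=1}^r β_k log(t_k). -/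

import Mathlib

open Matrix BigOperators

/-- Euclidean norm on `Fin n → ℝ`. -/
noncomputable def euclNorm {n : ℕ} (v : Fin n → ℝ) : ℝ :=
  Real.sqrt (∑ i, v i ^ 2)

/-- Information matrix of the `k`-th model: `M_{(k)}(w) = ∑ i, w i • A k iᵀ A k i`. -/
noncomputable def infoMatK {s l m r : ℕ}
    (A : Fin r → Fin s → Matrix (Fin l) (Fin m) ℝ) (k : Fin r) (w : Fin s → ℝ) :
    Matrix (Fin m) (Fin m) ℝ :=
  ∑ i, w i • ((A k i)ᵀ * A k i)

/-- A design: nonnegative weights summing to one. -/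
def IsDesign {s : ℕ} (w : Fin s → ℝ) : Prop :=
  (∀ i, 0 ≤ w i) ∧ ∑ i, w i = 1

/-- `w` is feasible when every `c k` lies in the range of `M_{(k)}(w)`. -/
def FeasibleS {s l m r : ℕ} (A : Fin r → Fin s → Matrix (Fin l) (Fin m) ℝ)
    (c : Fin r → Fin m → ℝ) (w : Fin s → ℝ) : Prop :=
  ∀ k, ∃ u, infoMatK A k w *ᵥ u = c k

/-- The set of values of the `S_β`-criterion `∑ k, β k * log (c k ⬝ᵥ u k)` of `w`,
over all witnesses `u k` with `M_{(k)}(w) (u k) = c k` (it is a singleton when `w` is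
feasible, since the value does not depend on the witnesses). -/
def SVal {s l m r : ℕ} (A : Fin r → Fin s → Matrix (Fin l) (Fin m) ℝ)
    (c : Fin r → Fin m → ℝ) (β : Fin r → ℝ) (w : Fin s → ℝ) : Set ℝ :=
  {x | ∃ u : Fin r → Fin m → ℝ, (∀ k, infoMatK A k w *ᵥ u k = c k) ∧
    x = ∑ k, β k * Real.log (c k ⬝ᵥ u k)}

/-- `w` is an `S_β`-optimal design: a feasible design minimizing the `S_β`-criterion among
feasible designs. -/
def IsSOptimal {s l m r : ℕ} (A : Fin r → Fin s → Matrix (Fin l) (Fin m) ℝ)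
    (c : Fin r → Fin m → ℝ) (β : Fin r → ℝ) (w : Fin s → ℝ) : Prop :=
  IsDesign w ∧ FeasibleS A c w ∧
    ∀ (x : ℝ), x ∈ SVal A c β w →
      ∀ (w' : Fin s → ℝ) (x' : ℝ), IsDesign w' → FeasibleS A c w' →
        x' ∈ SVal A c β w' → x ≤ x'

/-- The generalized Elfving set `D_β ⊆ ℝ^{r×m}` for `S_β`-optimality: the convex hull of
the matrices whose `k`-th row is `(ε k)ᵀ A k i`, with `∑ k, β k ‖ε k‖² ≤ 1`. -/
def DβSet {s l m r : ℕ} (A : Fin r → Fin s → Matrix (Fin l) (Fin m) ℝ)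
    (β : Fin r → ℝ) : Set (Matrix (Fin r) (Fin m) ℝ) :=
  convexHull ℝ {B | ∃ (i : Fin s) (ε : Fin r → Fin l → ℝ),
    (∑ k, β k * euclNorm (ε k) ^ 2 ≤ 1) ∧
    B = Matrix.of fun k => (A k i)ᵀ *ᵥ ε k}

lemma euclNorm_sq {n : ℕ} (v : Fin n → ℝ) : euclNorm v ^ 2 = v ⬝ᵥ v := by
  rw [euclNorm, Real.sq_sqrt (Finset.sum_nonneg fun i _ => sq_nonneg _)]
  simp [dotProduct, sq]

/-- The weighted inner product `∑ i, w i * ⟨x i, y i⟩` of two families of vectors. -/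
def weightedDot {s l : ℕ} (w : Fin s → ℝ) (x y : Fin s → Fin l → ℝ) : ℝ :=
  ∑ i, w i * (x i ⬝ᵥ y i)

lemma weightedDot_self_nonneg {s l : ℕ} {w : Fin s → ℝ} (hw : ∀ i, 0 ≤ w i)
    (x : Fin s → Fin l → ℝ) : 0 ≤ weightedDot w x x :=
  Finset.sum_nonneg fun i _ => mul_nonneg (hw i) (euclNorm_sq (x i) ▸ sq_nonneg _)

lemma weightedDot_sub_smul_self {s l : ℕ} (w : Fin s → ℝ) (x y : Fin s → Fin l → ℝ) (a : ℝ) :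
    weightedDot w (x - a • y) (x - a • y) =
      weightedDot w x x - 2 * a * weightedDot w x y + a ^ 2 * weightedDot w y y := by
  simp only [weightedDot, Finset.mul_sum, ← Finset.sum_sub_distrib, ← Finset.sum_add_distrib]
  refine Finset.sum_congr rfl fun i _ => ?_
  simp only [Pi.sub_apply, Pi.smul_apply, sub_dotProduct, dotProduct_sub, smul_dotProduct,
    dotProduct_smul, smul_eq_mul, dotProduct_comm (y i) (x i)]
  ring

lemma smul_eq_zero_of_weightedDot_self {s l : ℕ} {w : Fin s → ℝ} (hw : ∀ i, 0 ≤ w i)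
    {x : Fin s → Fin l → ℝ} (h : weightedDot w x x = 0) (i : Fin s) : w i • x i = 0 := by
  have h0 := (Finset.sum_eq_zero_iff_of_nonneg
    fun i _ => mul_nonneg (hw i) (euclNorm_sq (x i) ▸ sq_nonneg _)).1 h i (Finset.mem_univ i)
  rcases mul_eq_zero.1 h0 with h1 | h1
  · simp [h1]
  · simp [dotProduct_self_eq_zero.1 h1]

lemma weightedDot_inv_le {s l : ℕ} {w : Fin s → ℝ} (hw : ∀ i, 0 ≤ w i)
    {x y : Fin s → Fin l → ℝ} (h : weightedDot w x y = 1) :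
    0 < weightedDot w y y ∧ (weightedDot w y y)⁻¹ ≤ weightedDot w x x := by
  have key : ∀ a : ℝ, 0 ≤ weightedDot w x x - 2 * a + a ^ 2 * weightedDot w y y := fun a => by
    have := weightedDot_self_nonneg hw (x - a • y)
    rw [weightedDot_sub_smul_self, h] at this
    linarith
  have hy : 0 < weightedDot w y y := by
    refine (weightedDot_self_nonneg hw y).lt_of_ne fun h0 => ?_
    have := key (weightedDot w x x + 1)
    rw [← h0] at this
    have := weightedDot_self_nonneg hw x
    linarith
  refine ⟨hy, ?_⟩
  have := key (weightedDot w y y)⁻¹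
  have h1 : (weightedDot w y y)⁻¹ ^ 2 * weightedDot w y y = (weightedDot w y y)⁻¹ := by
    field_simp
  linarith

/-- The linear combination `∑ i, w i • (A i)ᵀ x i`. -/
def weightedSum {s l m : ℕ} (A : Fin s → Matrix (Fin l) (Fin m) ℝ) (w : Fin s → ℝ)
    (x : Fin s → Fin l → ℝ) : Fin m → ℝ :=
  ∑ i, w i • ((A i)ᵀ *ᵥ x i)

lemma dotProduct_weightedSum {s l m : ℕ} (A : Fin s → Matrix (Fin l) (Fin m) ℝ) (w : Fin s → ℝ)
    (x : Fin s → Fin l → ℝ) (u : Fin m → ℝ) :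
    u ⬝ᵥ weightedSum A w x = weightedDot w (fun i => A i *ᵥ u) x := by
  simp only [weightedSum, weightedDot, dotProduct_sum, dotProduct_smul, smul_eq_mul,
    dotProduct_mulVec, vecMul_transpose]

lemma weightedSum_smul {s l m : ℕ} (A : Fin s → Matrix (Fin l) (Fin m) ℝ) (w : Fin s → ℝ)
    (x : Fin s → Fin l → ℝ) (a : ℝ) : weightedSum A w (a • x) = a • weightedSum A w x := by
  simp only [weightedSum, Pi.smul_apply, mulVec_smul, Finset.smul_sum, smul_comm a]

lemma weightedSum_congr {s l m : ℕ} (A : Fin s → Matrix (Fin l) (Fin m) ℝ) {w : Fin s → ℝ}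
    {x y : Fin s → Fin l → ℝ} (h : ∀ i, w i • x i = w i • y i) :
    weightedSum A w x = weightedSum A w y := by
  simp only [weightedSum, ← mulVec_smul, h]

lemma infoMatK_mulVec {s l m r : ℕ} (A : Fin r → Fin s → Matrix (Fin l) (Fin m) ℝ) (k : Fin r)
    (w : Fin s → ℝ) (u : Fin m → ℝ) :
    infoMatK A k w *ᵥ u = weightedSum (A k) w fun i => A k i *ᵥ u := by
  simp only [infoMatK, weightedSum, sum_mulVec, smul_mulVec, mulVec_mulVec]

lemma exists_weightedSum_mulVec_eq {s l m : ℕ} (A : Fin s → Matrix (Fin l) (Fin m) ℝ)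
    {w : Fin s → ℝ} (hw : ∀ i, 0 ≤ w i) (x : Fin s → Fin l → ℝ) :
    ∃ u, (weightedSum A w fun i => A i *ᵥ u) = weightedSum A w x := by
  let X : Matrix (Fin s × Fin l) (Fin m) ℝ := Matrix.of fun p j => √(w p.1) * A p.1 p.2 j
  have hX : ∀ y : Fin s → Fin l → ℝ,
      Xᵀ *ᵥ (fun p => √(w p.1) * y p.1 p.2) = weightedSum A w y := fun y => by
    ext j
    simp only [X, weightedSum, mulVec, dotProduct, transpose_apply, of_apply, Finset.sum_apply,
      Pi.smul_apply, smul_eq_mul, Finset.mul_sum, Fintype.sum_prod_type]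
    refine Finset.sum_congr rfl fun i _ => Finset.sum_congr rfl fun a _ => ?_
    linear_combination (A i a j * y i a) * Real.mul_self_sqrt (hw i)
  have hr : (Xᵀ * X).mulVecLin.range = Xᵀ.mulVecLin.range := by
    refine Submodule.eq_of_le_of_finrank_eq ?_ ?_
    · rintro _ ⟨v, rfl⟩
      exact ⟨X *ᵥ v, by simp⟩
    · change (Xᵀ * X).rank = Xᵀ.rank
      rw [rank_transpose_mul_self, rank_transpose]
  obtain ⟨u, hu⟩ : weightedSum A w x ∈ (Xᵀ * X).mulVecLin.range := by
    rw [hr, ← hX x]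
    exact ⟨_, rfl⟩
  refine ⟨u, ?_⟩
  rw [← hu, ← hX, mulVecLin_apply, ← mulVec_mulVec]
  congr 1
  ext p
  simp [X, mulVec, dotProduct, Finset.mul_sum, mul_assoc]

lemma sum_log_le_zero_of_le {r : ℕ} {β z y : Fin r → ℝ} (hβ : ∀ k, 0 < β k)
    (hβ1 : ∑ k, β k = 1) (hz : ∀ k, 0 < z k) (hzy : ∀ k, z k ≤ y k)
    (hy : ∑ k, β k * y k ≤ 1) : ∑ k, β k * Real.log (z k) ≤ 0 :=
  calc ∑ k, β k * Real.log (z k) ≤ ∑ k, β k * (y k - 1) :=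
        Finset.sum_le_sum fun k _ => mul_le_mul_of_nonneg_left
          ((Real.log_le_sub_one_of_pos (hz k)).trans (by linarith [hzy k])) (hβ k).le
    _ = ∑ k, β k * y k - 1 := by simp [mul_sub, hβ1]
    _ ≤ 0 := by linarith

lemma eq_one_of_sum_log_eq_zero {r : ℕ} {β z y : Fin r → ℝ} (hβ : ∀ k, 0 < β k)
    (hβ1 : ∑ k, β k = 1) (hz : ∀ k, 0 < z k) (hzy : ∀ k, z k ≤ y k)
    (hy : ∑ k, β k * y k ≤ 1) (h : ∑ k, β k * Real.log (z k) = 0) (k : Fin r) :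
    z k = 1 ∧ y k = 1 := by
  have h1 : ∀ k, 0 ≤ β k * (y k - 1 - Real.log (z k)) := fun k =>
    mul_nonneg (hβ k).le (by linarith [hzy k, Real.log_le_sub_one_of_pos (hz k)])
  have h2 : ∑ k, β k * (y k - 1 - Real.log (z k)) = 0 := by
    refine le_antisymm ?_ (Finset.sum_nonneg fun k _ => h1 k)
    simp only [mul_sub, Finset.sum_sub_distrib, mul_one, hβ1, h]
    linarith
  have h3 := (Finset.sum_eq_zero_iff_of_nonneg fun k _ => h1 k).1 h2 k (Finset.mem_univ k)
  have h4 : y k - 1 - Real.log (z k) = 0 := (mul_eq_zero.1 h3).resolve_left (hβ k).ne'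
  have hz1 : z k = 1 := by
    by_contra hne
    linarith [hzy k, Real.log_lt_sub_one_of_pos (hz k) hne]
  exact ⟨hz1, by rw [hz1, Real.log_one] at h4; linarith⟩

lemma sum_log_sq_mul {r : ℕ} (β t ρ : Fin r → ℝ) (ht : ∀ k, 0 < t k) (hρ : ∀ k, 0 < t k ^ 2 * ρ k) :
    ∑ k, β k * Real.log (t k ^ 2 * ρ k) =
      ∑ k, β k * Real.log (ρ k) + 2 * ∑ k, β k * Real.log (t k) := by
  rw [Finset.mul_sum, ← Finset.sum_add_distrib]
  refine Finset.sum_congr rfl fun k _ => ?_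
  have h1 : 0 < ρ k := pos_of_mul_pos_right (hρ k) (sq_nonneg _)
  rw [Real.log_mul (by have := ht k; positivity) h1.ne', Real.log_pow]
  push_cast
  ring

lemma sum_mul_weightedDot_self_le_one {s l r : ℕ} {β : Fin r → ℝ} {w : Fin s → ℝ}
    (hw : IsDesign w) {ε : Fin s → Fin r → Fin l → ℝ}
    (hε : ∀ i, ∑ k, β k * euclNorm (ε i k) ^ 2 ≤ 1) :
    ∑ k, β k * weightedDot w (fun i => ε i k) (fun i => ε i k) ≤ 1 := by
  calc ∑ k, β k * weightedDot w (fun i => ε i k) (fun i => ε i k)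
      = ∑ i, w i * ∑ k, β k * euclNorm (ε i k) ^ 2 := by
        simp only [weightedDot, Finset.mul_sum, euclNorm_sq]
        rw [Finset.sum_comm]
        exact Finset.sum_congr rfl fun i _ => Finset.sum_congr rfl fun k _ => by ring
    _ ≤ ∑ i, w i * 1 :=
        Finset.sum_le_sum fun i _ => mul_le_mul_of_nonneg_left (hε i) (hw.1 i)
    _ = 1 := by simp [hw.2]

/-- A primal certificate gives feasibility. -/
lemma feasibleS_of_weightedSum {s l m r : ℕ} {A : Fin r → Fin s → Matrix (Fin l) (Fin m) ℝ}
    {c : Fin r → Fin m → ℝ} {w : Fin s → ℝ} (hw : IsDesign w) {t : Fin r → ℝ}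
    {ε : Fin s → Fin r → Fin l → ℝ} (ht : ∀ k, 0 < t k)
    (hsum : ∀ k, weightedSum (A k) w (fun i => ε i k) = t k • c k) : FeasibleS A c w := by
  intro k
  obtain ⟨u, hu⟩ := exists_weightedSum_mulVec_eq (A k) hw.1 fun i => (t k)⁻¹ • ε i k
  refine ⟨u, ?_⟩
  rw [infoMatK_mulVec, hu]
  change weightedSum (A k) w ((t k)⁻¹ • fun i => ε i k) = _
  rw [weightedSum_smul, hsum, inv_smul_smul₀ (ht k).ne']

/-- A primal certificate bounds the criterion from above. -/
lemma SVal_le {s l m r : ℕ} {A : Fin r → Fin s → Matrix (Fin l) (Fin m) ℝ}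
    {c : Fin r → Fin m → ℝ} {β : Fin r → ℝ} (hβ : ∀ k, 0 < β k) (hβ1 : ∑ k, β k = 1)
    (hc : ∀ k, c k ≠ 0) {w : Fin s → ℝ} (hw : IsDesign w) {t : Fin r → ℝ}
    {ε : Fin s → Fin r → Fin l → ℝ} (ht : ∀ k, 0 < t k)
    (hε : ∀ i, ∑ k, β k * euclNorm (ε i k) ^ 2 ≤ 1)
    (hsum : ∀ k, weightedSum (A k) w (fun i => ε i k) = t k • c k) {x : ℝ}
    (hx : x ∈ SVal A c β w) : x ≤ -2 * ∑ k, β k * Real.log (t k) := by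
  obtain ⟨u, hu, rfl⟩ := hx
  simp only [infoMatK_mulVec] at hu
  let a : Fin r → Fin s → Fin l → ℝ := fun k => t k • fun i => A k i *ᵥ u k
  have ha : ∀ k, weightedSum (A k) w (a k) = t k • c k := fun k => by
    rw [weightedSum_smul, hu]
  have hdot : ∀ k y, weightedSum (A k) w y = t k • c k →
      weightedDot w (a k) y = t k ^ 2 * (c k ⬝ᵥ u k) := fun k y hy => by
    have h1 : weightedDot w (a k) y = (t k • u k) ⬝ᵥ weightedSum (A k) w y := by
      rw [dotProduct_weightedSum]
      congr 1
      ext1 i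
      simp [a, mulVec_smul]
    rw [h1, hy, smul_dotProduct, dotProduct_smul, dotProduct_comm, smul_eq_mul, smul_eq_mul]
    ring
  have haa := fun k => hdot k _ (ha k)
  have hpos : ∀ k, 0 < t k ^ 2 * (c k ⬝ᵥ u k) := fun k => by
    rw [← haa]
    refine (weightedDot_self_nonneg hw.1 _).lt_of_ne fun h0 => hc k ?_
    have h1 := smul_eq_zero_of_weightedDot_self hw.1 h0.symm
    have h2 : weightedSum (A k) w (a k) = 0 := by
      simp only [weightedSum, ← mulVec_smul, h1, mulVec_zero, Finset.sum_const_zero]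
    rw [ha] at h2
    exact (smul_eq_zero.1 h2).resolve_left (ht k).ne'
  have hle : ∀ k, t k ^ 2 * (c k ⬝ᵥ u k) ≤
      weightedDot w (fun i => ε i k) (fun i => ε i k) := fun k => by
    have h1 := weightedDot_self_nonneg hw.1 (a k - (1 : ℝ) • fun i => ε i k)
    rw [weightedDot_sub_smul_self, haa, hdot k _ (hsum k)] at h1
    linarith
  have := sum_log_le_zero_of_le hβ hβ1 hpos hle (sum_mul_weightedDot_self_le_one hw hε)
  rw [sum_log_sq_mul β t _ ht hpos] at this
  linarith

/-- A dual certificate bounds the criterion from below, and in the case of equality it is itself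
a primal certificate. -/
lemma le_SVal {s l m r : ℕ} {A : Fin r → Fin s → Matrix (Fin l) (Fin m) ℝ}
    {c : Fin r → Fin m → ℝ} {β : Fin r → ℝ} (hβ : ∀ k, 0 < β k) (hβ1 : ∑ k, β k = 1)
    {w : Fin s → ℝ} (hw : IsDesign w) {t : Fin r → ℝ} (ht : ∀ k, 0 < t k)
    {H : Matrix (Fin r) (Fin m) ℝ}
    (hH : ∀ i, ∑ k, β k * euclNorm ((β k)⁻¹ • (A k i *ᵥ H k)) ^ 2 ≤ 1)
    (hHc : ∀ k, t k * (H k ⬝ᵥ c k) = β k) {x : ℝ} (hx : x ∈ SVal A c β w) :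
    -2 * ∑ k, β k * Real.log (t k) ≤ x ∧
      (x = -2 * ∑ k, β k * Real.log (t k) →
        ∀ k, weightedSum (A k) w (fun i => (β k)⁻¹ • (A k i *ᵥ H k)) = t k • c k) := by
  obtain ⟨u, hu, rfl⟩ := hx
  simp only [infoMatK_mulVec] at hu
  let a : Fin r → Fin s → Fin l → ℝ := fun k => t k • fun i => A k i *ᵥ u k
  let e : Fin r → Fin s → Fin l → ℝ := fun k i => (β k)⁻¹ • (A k i *ᵥ H k)
  have ha : ∀ k, weightedSum (A k) w (a k) = t k • c k := fun k => by
    rw [weightedSum_smul, hu]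
  have haa : ∀ k, weightedDot w (a k) (a k) = t k ^ 2 * (c k ⬝ᵥ u k) := fun k => by
    have h1 : weightedDot w (a k) (a k) = (t k • u k) ⬝ᵥ weightedSum (A k) w (a k) := by
      rw [dotProduct_weightedSum]
      congr 1
      ext1 i
      simp [a, mulVec_smul]
    rw [h1, ha, smul_dotProduct, dotProduct_smul, dotProduct_comm, smul_eq_mul, smul_eq_mul]
    ring
  have hea : ∀ k, weightedDot w (e k) (a k) = 1 := fun k => by
    have h1 : weightedDot w (e k) (a k) = ((β k)⁻¹ • H k) ⬝ᵥ weightedSum (A k) w (a k) := by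
      rw [dotProduct_weightedSum]
      congr 1
      ext1 i
      simp [e, mulVec_smul]
    rw [h1, ha, smul_dotProduct, dotProduct_smul, smul_eq_mul, smul_eq_mul, hHc,
      inv_mul_cancel₀ (hβ k).ne']
  have hz := fun k => weightedDot_inv_le hw.1 (hea k)
  simp only [haa] at hz
  have hy := sum_mul_weightedDot_self_le_one (ε := fun i k => e k i) hw hH
  have hlog : ∑ k, β k * Real.log (t k ^ 2 * (c k ⬝ᵥ u k))⁻¹ =
      -(∑ k, β k * Real.log (c k ⬝ᵥ u k) + 2 * ∑ k, β k * Real.log (t k)) := by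
    rw [← sum_log_sq_mul β t _ ht fun k => (hz k).1]
    simp only [Real.log_inv, mul_neg, Finset.sum_neg_distrib]
  constructor
  · have := sum_log_le_zero_of_le hβ hβ1 (fun k => inv_pos.2 (hz k).1) (fun k => (hz k).2) hy
    linarith
  · intro hx k
    obtain ⟨h1, h2⟩ := eq_one_of_sum_log_eq_zero hβ hβ1 (fun k => inv_pos.2 (hz k).1)
      (fun k => (hz k).2) hy (by rw [hlog, hx]; ring) k
    rw [inv_eq_one] at h1
    have h3 : weightedDot w (e k - (1 : ℝ) • a k) (e k - (1 : ℝ) • a k) = 0 := by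
      rw [weightedDot_sub_smul_self, haa, hea, h1]
      linarith
    rw [← ha]
    refine weightedSum_congr _ fun i => sub_eq_zero.1 ?_
    rw [← smul_sub]
    simpa using smul_eq_zero_of_weightedDot_self hw.1 h3 i

open Filter Topology in
/-- First-order optimality condition for a weighted sum of logarithms. -/
lemma sum_mul_nonpos_of_sum_log_nonpos {ι : Type*} [Fintype ι] {β a : ι → ℝ}
    (h : ∀ᶠ δ in 𝓝[>] (0 : ℝ), ∑ k, β k * Real.log (1 + δ * a k) ≤ 0) :
    ∑ k, β k * a k ≤ 0 := by
  have hd : HasDerivAt (fun δ : ℝ => ∑ k, β k * Real.log (1 + δ * a k)) (∑ k, β k * a k) 0 := by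
    refine HasDerivAt.fun_sum fun k _ => HasDerivAt.const_mul (β k) ?_
    have h1 : HasDerivAt (fun δ : ℝ => 1 + δ * a k) (a k) 0 := by
      simpa using ((hasDerivAt_id (0 : ℝ)).mul_const (a k)).const_add 1
    simpa using h1.log (by simp)
  refine le_of_tendsto hd.tendsto_slope_zero_right ?_
  filter_upwards [h, self_mem_nhdsWithin] with δ hδ hpos
  have h0 : (0 : ℝ) < δ := hpos
  simpa using mul_nonpos_of_nonneg_of_nonpos (inv_nonneg.2 h0.le) hδ

open Filter Topology in
/-- Maximizing a weighted sum of logarithms of linear functionals over the unit ball of a seminorm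
on a subspace; the first-order condition extends to a functional dominated by the seminorm. -/
lemma exists_max_log_and_functional {E ι : Type*} [NormedAddCommGroup E] [NormedSpace ℝ E]
    [FiniteDimensional ℝ E] [Fintype ι] (p : Seminorm ℝ E) (hp : IsCompact {x | p x ≤ 1})
    (T : E →ₗ[ℝ] ι → ℝ) (L : Submodule ℝ E) {β : ι → ℝ} (hβ : ∀ k, 0 < β k)
    (hβ1 : ∑ k, β k = 1) {x₀ : E} (hx₀ : x₀ ∈ L) (hT₀ : ∀ k, 0 < T x₀ k) :
    ∃ x ∈ L, p x ≤ 1 ∧ (∀ k, 0 < T x k) ∧ ∃ g : E →ₗ[ℝ] ℝ, (∀ y, g y ≤ p y) ∧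
      ∀ y ∈ L, g y = ∑ k, β k * (T y k / T x k) := by
  have hTc : Continuous T := T.continuous_of_finiteDimensional
  have hTk : ∀ k, Continuous fun x => T x k := fun k => (continuous_apply k).comp hTc
  let K : Set E := {x | p x ≤ 1} ∩ (L ∩ ⋂ k, {x | 0 ≤ T x k})
  have hK : IsCompact K := hp.inter_right
    (L.closed_of_finiteDimensional.inter
      (isClosed_iInter fun k => isClosed_le continuous_const (hTk k)))
  have hf : Continuous fun x => ∏ k, T x k ^ β k :=
    continuous_finsetProd _ fun k _ => (hTk k).rpow_const fun _ => Or.inr (hβ k).le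
  have hN : 0 < p x₀ + 1 := by have := apply_nonneg p x₀; linarith
  have hT₁ : ∀ k, 0 < T ((p x₀ + 1)⁻¹ • x₀) k := fun k => by
    rw [map_smul]
    exact mul_pos (inv_pos.2 hN) (hT₀ k)
  have hx₁ : (p x₀ + 1)⁻¹ • x₀ ∈ K := by
    refine ⟨?_, L.smul_mem _ hx₀, Set.mem_iInter.2 fun k => (hT₁ k).le⟩
    change p _ ≤ 1
    rw [map_smul_eq_mul, Real.norm_of_nonneg (inv_nonneg.2 hN.le),
      inv_mul_le_one₀ hN]
    linarith
  obtain ⟨x, ⟨hxp, hxL, hxT⟩, hmax⟩ := hK.exists_isMaxOn ⟨_, hx₁⟩ hf.continuousOn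
  have hx0 : ∀ k, 0 ≤ T x k := fun k => Set.mem_iInter.1 hxT k
  have hprod : 0 < ∏ k, T x k ^ β k :=
    (Finset.prod_pos fun k _ => Real.rpow_pos_of_pos (hT₁ k) _).trans_le (hmax hx₁)
  have hxpos : ∀ k, 0 < T x k := fun k => (hx0 k).lt_of_ne fun h0 => by
    refine hprod.ne' (Finset.prod_eq_zero (Finset.mem_univ k) ?_)
    rw [← h0, Real.zero_rpow (hβ k).ne']
  refine ⟨x, hxL, hxp, hxpos, ?_⟩
  have hlog : ∀ y : E, (∀ k, 0 < T y k) →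
      Real.log (∏ k, T y k ^ β k) = ∑ k, β k * Real.log (T y k) := fun y hy => by
    rw [Real.log_prod fun k _ => (Real.rpow_pos_of_pos (hy k) _).ne']
    exact Finset.sum_congr rfl fun k _ => Real.log_rpow (hy k) _
  have hball : ∀ y ∈ L, p y ≤ 1 → ∑ k, β k * (T y k / T x k) ≤ 1 := by
    intro y hyL hyp
    have h1 : ∑ k, β k * (T y k / T x k - 1) ≤ 0 := by
      refine sum_mul_nonpos_of_sum_log_nonpos ?_
      have hev : ∀ k, ∀ᶠ δ in 𝓝[>] (0 : ℝ), 0 < 1 + δ * (T y k / T x k - 1) := fun k => by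
        refine nhdsWithin_le_nhds ?_
        have : Continuous fun δ : ℝ => 1 + δ * (T y k / T x k - 1) := by fun_prop
        exact this.continuousAt.eventually (lt_mem_nhds (by simp))
      filter_upwards [eventually_all.2 hev, Ioo_mem_nhdsGT (zero_lt_one' ℝ)] with δ hδ hδ1
      have hz : ∀ k, T ((1 - δ) • x + δ • y) k = T x k * (1 + δ * (T y k / T x k - 1)) :=
        fun k => by
          simp only [map_add, map_smul, Pi.add_apply, Pi.smul_apply, smul_eq_mul]
          field_simp [(hxpos k).ne']
          ring
      have hzpos : ∀ k, 0 < T ((1 - δ) • x + δ • y) k := fun k => by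
        rw [hz]
        exact mul_pos (hxpos k) (hδ k)
      have hzK : (1 - δ) • x + δ • y ∈ K := by
        refine ⟨?_, L.add_mem (L.smul_mem _ hxL) (L.smul_mem _ hyL),
          Set.mem_iInter.2 fun k => (hzpos k).le⟩
        refine (map_add_le_add p _ _).trans ?_
        rw [map_smul_eq_mul, map_smul_eq_mul, Real.norm_of_nonneg hδ1.1.le,
          Real.norm_of_nonneg (sub_nonneg.2 hδ1.2.le)]
        have h2 := mul_le_mul_of_nonneg_left hxp (sub_nonneg.2 hδ1.2.le)
        have h3 := mul_le_mul_of_nonneg_left hyp hδ1.1.le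
        linarith
      have h2 := Real.log_le_log (Finset.prod_pos fun k _ => Real.rpow_pos_of_pos (hzpos k) _)
        (hmax hzK)
      rw [hlog _ hzpos, hlog _ hxpos] at h2
      have h3 : ∀ k, Real.log (T ((1 - δ) • x + δ • y) k) =
          Real.log (T x k) + Real.log (1 + δ * (T y k / T x k - 1)) := fun k => by
        rw [hz, Real.log_mul (hxpos k).ne' (hδ k).ne']
      simp only [h3, mul_add (β _), Finset.sum_add_distrib] at h2
      linarith
    simp only [mul_sub, Finset.sum_sub_distrib, mul_one, hβ1] at h1
    linarith
  let f : E →ₗ[ℝ] ℝ :=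
    ∑ k, (β k / T x k) • (LinearMap.proj k ∘ₗ T)
  have hf_apply : ∀ y, f y = ∑ k, β k * (T y k / T x k) := fun y => by
    simp only [f, LinearMap.sum_apply, LinearMap.smul_apply, LinearMap.comp_apply,
      LinearMap.proj_apply, smul_eq_mul]
    exact Finset.sum_congr rfl fun k _ => by ring
  obtain ⟨g, hg, hgp⟩ := exists_extension_of_le_sublinear ⟨L, f.domRestrict L⟩ p
    (fun a ha y => by rw [map_smul_eq_mul, Real.norm_of_nonneg ha.le])
    (map_add_le_add p) (fun y => by
      refine le_of_forall_gt fun a ha => ?_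
      have ha0 : 0 < a := (apply_nonneg p _).trans_lt ha
      obtain ⟨b, hb, hba⟩ := exists_between ha
      have hb0 : 0 < b := (apply_nonneg p _).trans_lt hb
      have h1 : f (b⁻¹ • (y : E)) ≤ 1 := by
        rw [hf_apply]
        refine hball _ (L.smul_mem _ y.2) ?_
        rw [map_smul_eq_mul, Real.norm_of_nonneg (inv_nonneg.2 hb0.le), inv_mul_le_one₀ hb0]
        exact hb.le
      rw [map_smul, smul_eq_mul, inv_mul_le_one₀ hb0] at h1
      exact h1.trans_lt hba)
  exact ⟨g, hgp, fun y hy => (hg ⟨y, hy⟩).trans (hf_apply y)⟩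

/-- The weighted Euclidean norm `√(∑ k, β k * ‖e k‖²)` on families of vectors. -/
noncomputable def blockNorm {r l : ℕ} (β : Fin r → ℝ) (e : Fin r → Fin l → ℝ) : ℝ :=
  ‖WithLp.toLp 2 fun p : Fin r × Fin l => √(β p.1) * e p.1 p.2‖

lemma blockNorm_sq {r l : ℕ} {β : Fin r → ℝ} (hβ : ∀ k, 0 < β k) (e : Fin r → Fin l → ℝ) :
    blockNorm β e ^ 2 = ∑ k, β k * euclNorm (e k) ^ 2 := by
  simp only [blockNorm, EuclideanSpace.norm_sq_eq, euclNorm_sq, dotProduct,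
    Fintype.sum_prod_type, Finset.mul_sum, Real.norm_eq_abs, sq_abs, mul_pow,
    Real.sq_sqrt (hβ _).le, ← sq]

lemma blockNorm_add_le {r l : ℕ} (β : Fin r → ℝ) (e f : Fin r → Fin l → ℝ) :
    blockNorm β (e + f) ≤ blockNorm β e + blockNorm β f := by
  refine (le_of_eq ?_).trans (norm_add_le _ _)
  rw [blockNorm, ← WithLp.toLp_add]
  congr 2
  ext p
  exact mul_add _ _ _

lemma blockNorm_smul {r l : ℕ} (β : Fin r → ℝ) (a : ℝ) (e : Fin r → Fin l → ℝ) :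
    blockNorm β (a • e) = ‖a‖ * blockNorm β e := by
  rw [blockNorm, blockNorm, ← norm_smul, ← WithLp.toLp_smul]
  congr 2
  ext p
  exact mul_left_comm _ _ _

/-- The sum of the norms `blockNorm β (η i)`, as a seminorm. -/
noncomputable def blockSeminorm {r l : ℕ} (s : ℕ) (β : Fin r → ℝ) :
    Seminorm ℝ (Fin s → Fin r → Fin l → ℝ) :=
  Seminorm.of (fun η => ∑ i, blockNorm β (η i))
    (fun η ξ => by
      rw [← Finset.sum_add_distrib]
      exact Finset.sum_le_sum fun i _ => blockNorm_add_le β (η i) (ξ i))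
    (fun a η => by
      rw [Finset.mul_sum]
      exact Finset.sum_congr rfl fun i _ => blockNorm_smul β a (η i))

lemma blockSeminorm_apply {s r l : ℕ} (β : Fin r → ℝ) (η : Fin s → Fin r → Fin l → ℝ) :
    blockSeminorm s β η = ∑ i, blockNorm β (η i) := rfl

lemma isCompact_blockSeminorm_le_one {s r l : ℕ} {β : Fin r → ℝ} (hβ : ∀ k, 0 < β k) :
    IsCompact {η : Fin s → Fin r → Fin l → ℝ | blockSeminorm s β η ≤ 1} := by
  have hcont : Continuous fun η : Fin s → Fin r → Fin l → ℝ => blockSeminorm s β η := by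
    simp only [blockSeminorm_apply, blockNorm]
    fun_prop
  refine IsCompact.of_isClosed_subset
    (isCompact_univ_pi fun i : Fin s => isCompact_univ_pi fun k : Fin r =>
      isCompact_univ_pi fun j : Fin l =>
        isCompact_Icc (a := -(√(β k))⁻¹) (b := (√(β k))⁻¹))
    (isClosed_le hcont continuous_const) fun η hη i _ k _ j _ => ?_
  have hk : 0 < √(β k) := Real.sqrt_pos.2 (hβ k)
  have h1 : |√(β k) * η i k j| ≤ blockNorm β (η i) :=
    PiLp.norm_apply_le (WithLp.toLp 2 fun p : Fin r × Fin l => √(β p.1) * η i p.1 p.2) (k, j)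
  have h2 : blockNorm β (η i) ≤ ∑ i, blockNorm β (η i) :=
    Finset.single_le_sum (f := fun i => blockNorm β (η i)) (fun i _ => norm_nonneg _)
      (Finset.mem_univ i)
  rw [abs_mul, abs_of_pos hk] at h1
  have h3 : |η i k j| ≤ (√(β k))⁻¹ := by
    rw [← one_div, le_div_iff₀ hk, mul_comm]
    exact h1.trans (h2.trans hη)
  exact abs_le.1 h3

/-- The matrix with rows `∑ i, (A k i)ᵀ η i k`, as a linear function of `η`. -/
def blockSum {s l m r : ℕ} (A : Fin r → Fin s → Matrix (Fin l) (Fin m) ℝ) :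
    (Fin s → Fin r → Fin l → ℝ) →ₗ[ℝ] Matrix (Fin r) (Fin m) ℝ where
  toFun η := Matrix.of fun k => ∑ i, (A k i)ᵀ *ᵥ η i k
  map_add' η ξ := by
    ext k j
    simp [mulVec_add, Finset.sum_add_distrib]
  map_smul' a η := by
    ext k j
    simp [mulVec_smul, Finset.mul_sum]

lemma blockSum_apply {s l m r : ℕ} (A : Fin r → Fin s → Matrix (Fin l) (Fin m) ℝ)
    (η : Fin s → Fin r → Fin l → ℝ) (k : Fin r) :
    blockSum A η k = ∑ i, (A k i)ᵀ *ᵥ η i k := rfl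

lemma linearMap_apply_eq_sum_dotProduct {m r : ℕ} (φ : Matrix (Fin r) (Fin m) ℝ →ₗ[ℝ] ℝ)
    (B : Matrix (Fin r) (Fin m) ℝ) :
    φ B = ∑ k, (fun j => φ (Matrix.single k j 1)) ⬝ᵥ B k := by
  conv_lhs => rw [matrix_eq_sum_single B]
  simp only [map_sum, dotProduct]
  refine Finset.sum_congr rfl fun k _ => Finset.sum_congr rfl fun j _ => ?_
  rw [mul_comm, ← smul_eq_mul, ← map_smul, smul_single, smul_eq_mul, mul_one]

lemma trace_mul_transpose_eq_sum_dotProduct {m r : ℕ} (H D : Matrix (Fin r) (Fin m) ℝ) :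
    trace (H * Dᵀ) = ∑ k, H k ⬝ᵥ D k := rfl

/-- A linear functional bounded by one on a block ellipsoid satisfies the dual norm bound. -/
lemma sum_mul_euclNorm_sq_le_one {l m r : ℕ} {A : Fin r → Matrix (Fin l) (Fin m) ℝ}
    {β : Fin r → ℝ} (hβ : ∀ k, 0 < β k) {H : Matrix (Fin r) (Fin m) ℝ}
    (hH : ∀ ε : Fin r → Fin l → ℝ, ∑ k, β k * euclNorm (ε k) ^ 2 ≤ 1 →
      ∑ k, H k ⬝ᵥ ((A k)ᵀ *ᵥ ε k) ≤ 1) :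
    ∑ k, β k * euclNorm ((β k)⁻¹ • (A k *ᵥ H k)) ^ 2 ≤ 1 := by
  set ε₀ : Fin r → Fin l → ℝ := fun k => (β k)⁻¹ • (A k *ᵥ H k) with hε₀
  set Q := ∑ k, β k * euclNorm (ε₀ k) ^ 2 with hQ
  by_contra! hlt
  have hQ0 : 0 < Q := one_pos.trans hlt
  have hs : 0 < √Q := Real.sqrt_pos.2 hQ0
  have hval : ∑ k, H k ⬝ᵥ ((A k)ᵀ *ᵥ ε₀ k) = Q := Finset.sum_congr rfl fun k _ => by
    rw [euclNorm_sq, dotProduct_mulVec, vecMul_transpose]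
    conv_rhs => rw [hε₀, smul_dotProduct, smul_eq_mul, mul_inv_cancel_left₀ (hβ k).ne']
  have h1 := hH (fun k => (√Q)⁻¹ • ε₀ k) (by
    simp only [euclNorm_sq, smul_dotProduct, dotProduct_smul, smul_eq_mul] at hQ ⊢
    refine le_of_eq ?_
    calc ∑ k, β k * ((√Q)⁻¹ * ((√Q)⁻¹ * (ε₀ k ⬝ᵥ ε₀ k))) = (√Q * √Q)⁻¹ * Q := by
          rw [hQ, Finset.mul_sum, ← hQ, mul_inv]
          exact Finset.sum_congr rfl fun k _ => by ring
      _ = 1 := by rw [Real.mul_self_sqrt hQ0.le, inv_mul_cancel₀ hQ0.ne'])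
  simp only [mulVec_smul, dotProduct_smul, smul_eq_mul, ← Finset.mul_sum, hval] at h1
  rw [inv_mul_le_one₀ hs] at h1
  have h2 := Real.mul_self_sqrt hQ0.le
  have h3 : 1 < √Q := by rwa [Real.lt_sqrt one_pos.le, one_pow]
  nlinarith

/-- A family in the unit ball of `blockSeminorm` is a design-weighted family in the unit ball of
`blockNorm`. -/
lemma exists_isDesign_smul_eq {s l r : ℕ} (hs : 0 < s) {β : Fin r → ℝ} (hβ : ∀ k, 0 < β k)
    {η : Fin s → Fin r → Fin l → ℝ} (hη : blockSeminorm s β η ≤ 1) :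
    ∃ (w : Fin s → ℝ) (ε : Fin s → Fin r → Fin l → ℝ), IsDesign w ∧
      (∀ i, ∑ k, β k * euclNorm (ε i k) ^ 2 ≤ 1) ∧ ∀ i, w i • ε i = η i := by
  have hs' : (0 : ℝ) < s := Nat.cast_pos.2 hs
  rw [blockSeminorm_apply] at hη
  have hnn : ∀ i, 0 ≤ blockNorm β (η i) := fun i => norm_nonneg _
  set d : ℝ := (1 - ∑ i, blockNorm β (η i)) / s with hd
  have hd0 : 0 ≤ d := div_nonneg (by linarith) hs'.le
  set w : Fin s → ℝ := fun i => blockNorm β (η i) + d with hw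
  have hle : ∀ i, blockNorm β (η i) ≤ w i := fun i => le_add_of_nonneg_right hd0
  have hw0 : ∀ i, 0 ≤ w i := fun i => (hnn i).trans (hle i)
  refine ⟨w, fun i => (w i)⁻¹ • η i, ⟨hw0, ?_⟩, fun i => ?_, fun i => ?_⟩
  · rw [hw, Finset.sum_add_distrib]
    simp only [Finset.sum_const, Finset.card_univ, Fintype.card_fin, nsmul_eq_mul, hd]
    field_simp
    ring
  · rw [← blockNorm_sq hβ, blockNorm_smul, Real.norm_of_nonneg (inv_nonneg.2 (hw0 i))]
    exact pow_le_one₀ (mul_nonneg (inv_nonneg.2 (hw0 i)) (hnn i))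
      (inv_mul_le_one_of_le₀ (hle i) (hw0 i))
  · rcases (hw0 i).eq_or_lt' with h0 | h0
    · have h1 : blockNorm β (η i) ^ 2 = 0 := by
        rw [le_antisymm ((hle i).trans h0.le) (hnn i), sq, mul_zero]
      rw [blockNorm_sq hβ, Finset.sum_eq_zero_iff_of_nonneg
        fun k _ => mul_nonneg (hβ k).le (sq_nonneg _)] at h1
      have h2 : η i = 0 := by
        ext1 k
        have h3 := (mul_eq_zero.1 (h1 k (Finset.mem_univ k))).resolve_left (hβ k).ne'
        rw [euclNorm_sq] at h3
        exact dotProduct_self_eq_zero.1 h3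
      simp [h2]
    · exact smul_inv_smul₀ h0.ne' _

/-- Strong duality: a primal certificate and a dual certificate with the same multipliers. -/
lemma exists_primal_dual_certificates {s l m r : ℕ}
    {A : Fin r → Fin s → Matrix (Fin l) (Fin m) ℝ} {c : Fin r → Fin m → ℝ} {β : Fin r → ℝ}
    (hs : 0 < s) (hβ : ∀ k, 0 < β k) (hβ1 : ∑ k, β k = 1) (hc : ∀ k, c k ≠ 0)
    (hrange : ∀ k, ∃ u, (∑ i, (A k i)ᵀ * A k i) *ᵥ u = c k) :
    ∃ (t : Fin r → ℝ) (w : Fin s → ℝ) (ε : Fin s → Fin r → Fin l → ℝ)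
      (H : Matrix (Fin r) (Fin m) ℝ), (∀ k, 0 < t k) ∧ IsDesign w ∧
      (∀ i, ∑ k, β k * euclNorm (ε i k) ^ 2 ≤ 1) ∧
      (∀ k, weightedSum (A k) w (fun i => ε i k) = t k • c k) ∧
      (∀ i (ε : Fin r → Fin l → ℝ), ∑ k, β k * euclNorm (ε k) ^ 2 ≤ 1 →
        ∑ k, H k ⬝ᵥ ((A k i)ᵀ *ᵥ ε k) ≤ 1) ∧
      ∀ k, t k * (H k ⬝ᵥ c k) = β k := by
  choose u hu using hrange
  have hcc : ∀ k, c k ⬝ᵥ c k ≠ 0 := fun k h => hc k (dotProduct_self_eq_zero.1 h)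
  let T : (Fin s → Fin r → Fin l → ℝ) →ₗ[ℝ] Fin r → ℝ :=
    { toFun := fun η k => (c k ⬝ᵥ c k)⁻¹ * (blockSum A η k ⬝ᵥ c k)
      map_add' := fun η ξ => by
        ext k
        rw [map_add, Pi.add_apply, ← mul_add, ← add_dotProduct]
        rfl
      map_smul' := fun a η => by
        ext k
        rw [map_smul, Pi.smul_apply, RingHom.id_apply, smul_eq_mul, mul_left_comm,
          ← smul_eq_mul a (_ ⬝ᵥ _), ← smul_dotProduct]
        rfl }
  let L : Submodule ℝ (Fin s → Fin r → Fin l → ℝ) :=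
    { carrier := {η | ∃ a : Fin r → ℝ, ∀ k, blockSum A η k = a k • c k}
      add_mem' := by
        rintro η ξ ⟨a, ha⟩ ⟨b, hb⟩
        refine ⟨a + b, fun k => ?_⟩
        rw [map_add, Pi.add_apply, add_smul, ← ha, ← hb]
        rfl
      zero_mem' := ⟨0, fun k => by rw [map_zero, Pi.zero_apply, zero_smul]; rfl⟩
      smul_mem' := by
        rintro b η ⟨a, ha⟩
        refine ⟨b • a, fun k => ?_⟩
        rw [map_smul, Pi.smul_apply, smul_assoc, ← ha]
        rfl }
  have hT : ∀ η (a : Fin r → ℝ), (∀ k, blockSum A η k = a k • c k) → ∀ k, T η k = a k :=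
    fun η a h k => by
      change (c k ⬝ᵥ c k)⁻¹ * (blockSum A η k ⬝ᵥ c k) = a k
      rw [h, smul_dotProduct, smul_eq_mul, mul_left_comm, inv_mul_cancel₀ (hcc k), mul_one]
  have hrow : ∀ b : Fin r → ℝ, ∀ k,
      blockSum A (fun i k => b k • (A k i *ᵥ u k)) k = b k • c k := fun b k => by
    simp only [blockSum_apply, mulVec_smul, mulVec_mulVec, ← Finset.smul_sum]
    rw [← sum_mulVec, hu]
  obtain ⟨η, hηL, hη1, hTpos, g, hgp, hg⟩ :=
    exists_max_log_and_functional (blockSeminorm s β) (isCompact_blockSeminorm_le_one hβ) T L hβ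
      hβ1 (x₀ := fun i k => (1 : Fin r → ℝ) k • (A k i *ᵥ u k)) ⟨1, hrow 1⟩
      fun k => by rw [hT _ _ (hrow 1)]; exact one_pos
  have hgL : ∀ ξ (a : Fin r → ℝ), (∀ k, blockSum A ξ k = a k • c k) →
      g ξ = ∑ k, β k * (a k / T η k) := fun ξ a h => by
    rw [hg ξ ⟨a, h⟩]
    simp only [hT ξ a h]
  obtain ⟨φ, hφ⟩ : g ∈ (blockSum A).dualMap.range := by
    rw [LinearMap.range_dualMap_eq_dualAnnihilator_ker, Submodule.mem_dualAnnihilator]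
    intro ξ hξ
    rw [hgL ξ 0 fun k => by rw [LinearMap.mem_ker.1 hξ, Pi.zero_apply, zero_smul]; rfl]
    simp
  have hφ' : ∀ ξ, φ (blockSum A ξ) = g ξ := fun ξ => by rw [← hφ]; rfl
  obtain ⟨w, ε, hw, hε, hwε⟩ := exists_isDesign_smul_eq hs hβ hη1
  refine ⟨T η, w, ε, fun k j => φ (Matrix.single k j 1), hTpos, hw, hε, fun k => ?_,
    fun i e he => ?_, fun k => ?_⟩
  · obtain ⟨a, ha⟩ := hηL
    rw [hT η a ha, ← ha, blockSum_apply, weightedSum]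
    refine Finset.sum_congr rfl fun i _ => ?_
    rw [← hwε, Pi.smul_apply, mulVec_smul]
  · have h1 : blockSum A (Pi.single i e) = Matrix.of fun k => (A k i)ᵀ *ᵥ e k := by
      ext1 k
      rw [blockSum_apply, Finset.sum_eq_single i]
      · simp
      · intro j _ hj
        simp [hj]
      · simp
    have h2 : blockSeminorm s β (Pi.single i e) = blockNorm β e := by
      rw [blockSeminorm_apply, Finset.sum_eq_single i]
      · simp
      · intro j _ hj
        have h3 : blockNorm β (0 : Fin r → Fin l → ℝ) = 0 := by
          simpa using blockNorm_smul β 0 (0 : Fin r → Fin l → ℝ)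
        rw [Pi.single_eq_of_ne hj, h3]
      · simp
    have h3 := hgp (Pi.single i e)
    rw [← hφ', h1, h2, linearMap_apply_eq_sum_dotProduct] at h3
    refine h3.trans ?_
    rwa [← sq_le_one_iff₀ (show 0 ≤ blockNorm β e from norm_nonneg _), blockNorm_sq hβ]
  · have h1 := hgL _ _ (hrow (Pi.single k 1))
    rw [← hφ', linearMap_apply_eq_sum_dotProduct, Finset.sum_eq_single k,
      Finset.sum_eq_single k, hrow, Pi.single_eq_same, one_smul] at h1
    · rw [h1]
      have := (hTpos k).ne'
      field_simp
    · intro j _ hj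
      simp [hj]
    · simp
    · intro j _ hj
      rw [hrow, Pi.single_eq_of_ne hj, zero_smul, dotProduct_zero]
    · simp

lemma sum_dotProduct_le_one_of_trace_le_one {s l m r : ℕ}
    {A : Fin r → Fin s → Matrix (Fin l) (Fin m) ℝ} {β : Fin r → ℝ}
    {H : Matrix (Fin r) (Fin m) ℝ} (hD : ∀ D ∈ DβSet A β, trace (H * Dᵀ) ≤ 1) (i : Fin s)
    (ε : Fin r → Fin l → ℝ) (hε : ∑ k, β k * euclNorm (ε k) ^ 2 ≤ 1) :
    ∑ k, H k ⬝ᵥ ((A k i)ᵀ *ᵥ ε k) ≤ 1 :=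
  hD _ (subset_convexHull ℝ _ ⟨i, ε, hε, rfl⟩)

lemma trace_le_one_of_sum_dotProduct_le_one {s l m r : ℕ}
    {A : Fin r → Fin s → Matrix (Fin l) (Fin m) ℝ} {β : Fin r → ℝ}
    {H : Matrix (Fin r) (Fin m) ℝ}
    (hH : ∀ i (ε : Fin r → Fin l → ℝ), ∑ k, β k * euclNorm (ε k) ^ 2 ≤ 1 →
      ∑ k, H k ⬝ᵥ ((A k i)ᵀ *ᵥ ε k) ≤ 1) (D : Matrix (Fin r) (Fin m) ℝ)
    (hD : D ∈ DβSet A β) : trace (H * Dᵀ) ≤ 1 := by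
  have hconv : Convex ℝ {D : Matrix (Fin r) (Fin m) ℝ | trace (H * Dᵀ) ≤ 1} :=
    convex_halfSpace_le
      ⟨fun x y => by rw [transpose_add, Matrix.mul_add, trace_add], fun a x => by simp⟩ 1
  refine convexHull_min ?_ hconv hD
  rintro _ ⟨i, ε, hε, rfl⟩
  exact hH i ε hε

open Filter Topology in
/-- A point where a linear functional attains its positive maximum over a set is a frontier
point. -/
lemma mem_frontier_of_trace_eq_one {m r : ℕ} {S : Set (Matrix (Fin r) (Fin m) ℝ)}
    {H B : Matrix (Fin r) (Fin m) ℝ} (hS : ∀ D ∈ S, trace (H * Dᵀ) ≤ 1) (hB : B ∈ S)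
    (h1 : trace (H * Bᵀ) = 1) : B ∈ frontier S := by
  refine ⟨subset_closure hB, fun hBint => ?_⟩
  have hcont : Continuous fun a : ℝ => a • B := continuous_id.smul continuous_const
  have hev : ∀ᶠ a in 𝓝 (1 : ℝ), a • B ∈ S := by
    refine hcont.continuousAt.eventually (mem_interior_iff_mem_nhds.1 ?_)
    simpa using hBint
  obtain ⟨a, ha, ha1⟩ : ∃ a : ℝ, a • B ∈ S ∧ a ∈ Set.Ioi (1 : ℝ) :=
    ((hev.filter_mono (nhdsWithin_le_nhds (s := Set.Ioi 1))).and self_mem_nhdsWithin).exists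
  have := hS _ ha
  rw [transpose_smul, Matrix.mul_smul, trace_smul, h1, smul_eq_mul, mul_one] at this
  exact absurd ha1 this.not_gt

lemma weightedSum_eq_smul_of_matrix_eq {s l m r : ℕ}
    {A : Fin r → Fin s → Matrix (Fin l) (Fin m) ℝ} {c : Fin r → Fin m → ℝ} {w : Fin s → ℝ}
    {t : Fin r → ℝ} {ε : Fin s → Fin r → Fin l → ℝ} :
    ((Matrix.of fun k => t k • c k) = ∑ i, w i • Matrix.of fun k => (A k i)ᵀ *ᵥ ε i k) ↔
      ∀ k, weightedSum (A k) w (fun i => ε i k) = t k • c k := by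
  have h : ∀ k, (∑ i, w i • Matrix.of fun k => (A k i)ᵀ *ᵥ ε i k) k =
      weightedSum (A k) w (fun i => ε i k) := fun k => by
    ext j
    rw [Matrix.sum_apply, weightedSum, Finset.sum_apply]
    rfl
  constructor
  · intro he k
    rw [← h, ← he]
    rfl
  · intro he
    funext k
    rw [h, he]
    rfl

/-- **Geometrical characterization of multiresponse `S_β`-optimality (Dette-type theorem).**
A design `w` is `S_β`-optimal iff there exist `t > 0`, vectors `ε i k` and a matrix `H` with
(i) `∑ k, β k ‖ε i k‖² ≤ 1`; (ii) `Diag(t) C = ∑ i, w i • B i`, `B i` having rows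
`(ε i k)ᵀ A k i`; (iii) `Diag(t) C` on the frontier of `D_β` with supporting hyperplane `H`;
(iv) `t k * (h kᵀ c k) = β k`. In that case `S_β(w) = -2 ∑ k, β k log (t k)`. -/
theorem sOptimal_geometric_characterization {s l m r : ℕ}
    (A : Fin r → Fin s → Matrix (Fin l) (Fin m) ℝ)
    (c : Fin r → Fin m → ℝ) (β : Fin r → ℝ)
    (hβ : ∀ k, 0 < β k) (hβ1 : ∑ k, β k = 1)
    (hc : ∀ k, c k ≠ 0)
    (hrange : ∀ k, ∃ u, (∑ i, (A k i)ᵀ * A k i) *ᵥ u = c k)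
    (w : Fin s → ℝ) (hw : IsDesign w) :
    (IsSOptimal A c β w ↔
      ∃ (t : Fin r → ℝ) (ε : Fin s → Fin r → Fin l → ℝ)
        (H : Matrix (Fin r) (Fin m) ℝ),
        (∀ k, 0 < t k) ∧
        (∀ i, ∑ k, β k * euclNorm (ε i k) ^ 2 ≤ 1) ∧
        ((Matrix.of fun k => t k • c k) =
          ∑ i, w i • Matrix.of fun k => (A k i)ᵀ *ᵥ ε i k) ∧
        (Matrix.of fun k => t k • c k) ∈ frontier (DβSet A β) ∧
        (∀ D ∈ DβSet A β, Matrix.trace (H * Dᵀ) ≤ 1) ∧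
        (∀ k, t k * (∑ j, H k j * c k j) = β k)) ∧
    (∀ (t : Fin r → ℝ) (ε : Fin s → Fin r → Fin l → ℝ)
        (H : Matrix (Fin r) (Fin m) ℝ),
      (∀ k, 0 < t k) →
      (∀ i, ∑ k, β k * euclNorm (ε i k) ^ 2 ≤ 1) →
      ((Matrix.of fun k => t k • c k) =
        ∑ i, w i • Matrix.of fun k => (A k i)ᵀ *ᵥ ε i k) →
      (Matrix.of fun k => t k • c k) ∈ frontier (DβSet A β) →
      (∀ D ∈ DβSet A β, Matrix.trace (H * Dᵀ) ≤ 1) →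
      (∀ k, t k * (∑ j, H k j * c k j) = β k) →
      ∀ x ∈ SVal A c β w, x = -2 * ∑ k, β k * Real.log (t k)) := by
  have hupper : ∀ (t : Fin r → ℝ) (ε : Fin s → Fin r → Fin l → ℝ), (∀ k, 0 < t k) →
      (∀ i, ∑ k, β k * euclNorm (ε i k) ^ 2 ≤ 1) →
      (∀ k, weightedSum (A k) w (fun i => ε i k) = t k • c k) →
      ∀ x ∈ SVal A c β w, x ≤ -2 * ∑ k, β k * Real.log (t k) :=
    fun t ε ht hε hsum x hx => SVal_le hβ hβ1 hc hw ht hε hsum hx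
  have hlower : ∀ (t : Fin r → ℝ) (H : Matrix (Fin r) (Fin m) ℝ), (∀ k, 0 < t k) →
      (∀ D ∈ DβSet A β, trace (H * Dᵀ) ≤ 1) → (∀ k, t k * (∑ j, H k j * c k j) = β k) →
      ∀ w' x, IsDesign w' → x ∈ SVal A c β w' → -2 * ∑ k, β k * Real.log (t k) ≤ x :=
    fun t H ht hD hHc w' x hw' hx =>
      (le_SVal hβ hβ1 hw' ht
        (fun i => sum_mul_euclNorm_sq_le_one hβ (sum_dotProduct_le_one_of_trace_le_one hD i))
        hHc hx).1
  refine ⟨⟨?_, ?_⟩, ?_⟩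
  · rintro ⟨-, hfeas, hopt⟩
    have hs : 0 < s := Nat.pos_of_ne_zero fun h0 => by
      subst h0
      simpa using hw.2
    obtain ⟨t, w', ε', H, ht, hw', hε', hsum', hH, hHc⟩ :=
      exists_primal_dual_certificates hs hβ hβ1 hc hrange
    have hfeas' := feasibleS_of_weightedSum hw' ht hsum'
    choose u hu using hfeas
    choose u' hu' using hfeas'
    have hquad := fun i => sum_mul_euclNorm_sq_le_one hβ (hH i)
    obtain ⟨hge, heq⟩ := le_SVal hβ hβ1 hw ht hquad hHc ⟨u, hu, rfl⟩
    have hle := (hopt _ ⟨u, hu, rfl⟩ w' _ hw' (fun k => ⟨u' k, hu' k⟩) ⟨u', hu', rfl⟩).trans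
      (SVal_le hβ hβ1 hc hw' ht hε' hsum' ⟨u', hu', rfl⟩)
    have hmat := weightedSum_eq_smul_of_matrix_eq.2 (heq (le_antisymm hle hge))
    have hD := trace_le_one_of_sum_dotProduct_le_one hH
    refine ⟨t, fun i k => (β k)⁻¹ • (A k i *ᵥ H k), H, ht, hquad, hmat,
      mem_frontier_of_trace_eq_one hD ?_ ?_, hD, hHc⟩
    · rw [hmat]
      exact (convex_convexHull ℝ _).sum_mem (fun i _ => hw.1 i) hw.2
        fun i _ => subset_convexHull ℝ _ ⟨i, _, hquad i, rfl⟩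
    · rw [trace_mul_transpose_eq_sum_dotProduct, ← hβ1]
      refine Finset.sum_congr rfl fun k _ => ?_
      rw [← hHc k, ← smul_eq_mul, ← dotProduct_smul]
      rfl
  · rintro ⟨t, ε, H, ht, hε, hmat, -, hD, hHc⟩
    have hsum := weightedSum_eq_smul_of_matrix_eq.1 hmat
    exact ⟨hw, feasibleS_of_weightedSum hw ht hsum, fun x hx w' x' hw' _ hx' =>
      (hupper t ε ht hε hsum x hx).trans (hlower t H ht hD hHc w' x' hw' hx')⟩
  · intro t ε H ht hε hmat _ hD hHc x hx
    exact le_antisymm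
      (hupper t ε ht hε (weightedSum_eq_smul_of_matrix_eq.1 hmat) x hx)
      (hlower t H ht hD hHc w x hw hx)
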